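/- (First integral of the spherical catenary equation.) Let γ(t) = Ψ(u(t), v(t)) be a nondegenerate curve on [a,b] whose geodesic curvature satisfies κ(t) = − v'(t) cosh(u(t))² / ( (sinh(u(t)) + λ) · |γ'(t)| ) for all t. Then the function t ↦ v'(t) cosh(u(t))² (sinh(u(t)) + λ) / |γ'(t)| is constant on [a,b]. -/

import Mathlib

noncomputable section

open Real

/-- Lorentzian inner product on `ℝ³`: `⟨p,q⟩ = p₁q₁ + p₂q₂ − p₃q₃`. -/
def lprod (p q : Fin 3 → ℝ) : ℝ := p 0 * q 0 + p 1 * q 1 - p 2 * q 2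

/-- Determinant of the 3×3 matrix with rows `a`, `b`, `c`. -/
def det3 (a b c : Fin 3 → ℝ) : ℝ :=
  a 0 * (b 1 * c 2 - b 2 * c 1) - a 1 * (b 0 * c 2 - b 2 * c 0)
    + a 2 * (b 0 * c 1 - b 1 * c 0)

/-- Parametrization `Ψ` of the de Sitter plane `S₁² ⊂ L³`. -/
def Psi (u v : ℝ) : Fin 3 → ℝ :=
  ![Real.cosh u * Real.cos v, Real.cosh u * Real.sin v, Real.sinh u]

/-- The velocity of `t ↦ Psi (u t) (v t)`. -/
theorem hasDerivAt_Psi {u v : ℝ → ℝ} {u' v' t : ℝ}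
    (hu : HasDerivAt u u' t) (hv : HasDerivAt v v' t) :
    HasDerivAt (fun t => Psi (u t) (v t))
      ![Real.sinh (u t) * u' * Real.cos (v t) - Real.cosh (u t) * Real.sin (v t) * v',
        Real.sinh (u t) * u' * Real.sin (v t) + Real.cosh (u t) * Real.cos (v t) * v',
        Real.cosh (u t) * u'] t := by
  rw [hasDerivAt_pi]
  intro i
  fin_cases i
  · exact (hu.cosh.mul hv.cos).congr_deriv (by simp; ring)
  · exact (hu.cosh.mul hv.sin).congr_deriv (by simp; ring)
  · exact hu.sinh

/-- The acceleration of `t ↦ Psi (u t) (v t)`. -/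
theorem hasDerivAt_velocity_Psi {u v u₁ v₁ : ℝ → ℝ} {u₂ v₂ t : ℝ}
    (hu : HasDerivAt u (u₁ t) t) (hv : HasDerivAt v (v₁ t) t)
    (hu₁ : HasDerivAt u₁ u₂ t) (hv₁ : HasDerivAt v₁ v₂ t) :
    HasDerivAt (fun t =>
      ![Real.sinh (u t) * u₁ t * Real.cos (v t) - Real.cosh (u t) * Real.sin (v t) * v₁ t,
        Real.sinh (u t) * u₁ t * Real.sin (v t) + Real.cosh (u t) * Real.cos (v t) * v₁ t,
        Real.cosh (u t) * u₁ t])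
      ![(Real.cosh (u t) * u₁ t ^ 2 + Real.sinh (u t) * u₂ - Real.cosh (u t) * v₁ t ^ 2)
            * Real.cos (v t)
          - (2 * Real.sinh (u t) * u₁ t * v₁ t + Real.cosh (u t) * v₂) * Real.sin (v t),
        (Real.cosh (u t) * u₁ t ^ 2 + Real.sinh (u t) * u₂ - Real.cosh (u t) * v₁ t ^ 2)
            * Real.sin (v t)
          + (2 * Real.sinh (u t) * u₁ t * v₁ t + Real.cosh (u t) * v₂) * Real.cos (v t),
        Real.sinh (u t) * u₁ t ^ 2 + Real.cosh (u t) * u₂] t := by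
  rw [hasDerivAt_pi]
  intro i
  fin_cases i
  · exact (((hu.sinh.mul hu₁).mul hv.cos).sub ((hu.cosh.mul hv.sin).mul hv₁)).congr_deriv
      (by simp; ring)
  · exact (((hu.sinh.mul hu₁).mul hv.sin).add ((hu.cosh.mul hv.cos).mul hv₁)).congr_deriv
      (by simp; ring)
  · exact (hu.cosh.mul hu₁).congr_deriv (by simp; ring)

/-- The triple product of position, velocity and acceleration of a curve in the de Sitter plane. -/
theorem det3_Psi_curve {u v : ℝ → ℝ} (hu : Differentiable ℝ u) (hv : Differentiable ℝ v)
    (hu' : Differentiable ℝ (deriv u)) (hv' : Differentiable ℝ (deriv v)) (t : ℝ) :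
    det3 (Psi (u t) (v t)) (deriv (fun t => Psi (u t) (v t)) t)
        (deriv (deriv fun t => Psi (u t) (v t)) t) =
      Real.cosh (u t) * (deriv (deriv u) t * deriv v t - deriv u t * deriv (deriv v) t)
        - 2 * deriv u t ^ 2 * deriv v t * Real.sinh (u t)
        + Real.sinh (u t) * Real.cosh (u t) ^ 2 * deriv v t ^ 3 := by
  have h₁ := fun t => hasDerivAt_Psi (hu t).hasDerivAt (hv t).hasDerivAt
  have h₂ := hasDerivAt_velocity_Psi (hu t).hasDerivAt (hv t).hasDerivAt
    (hu' t).hasDerivAt (hv' t).hasDerivAt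
  rw [deriv_eq h₁, h₂.deriv]
  simp only [det3, Psi, Matrix.cons_val]
  have hcs := Real.sin_sq_add_cos_sq (v t)
  have hch := Real.cosh_sq (u t)
  generalize Real.cosh (u t) = c at *
  generalize Real.sinh (u t) = s at *
  generalize Real.cos (v t) = x at *
  generalize Real.sin (v t) = y at *
  generalize deriv (deriv u) t = a₂
  generalize deriv (deriv v) t = w₂
  generalize deriv u t = a
  generalize deriv v t = w
  have hx : y ^ 2 = 1 - x ^ 2 := by linarith
  have hs : s ^ 2 = c ^ 2 - 1 := by linarith
  grind

theorem spherical_catenary_first_integral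
    (a b lam : ℝ) (hab : a < b)
    (u v : ℝ → ℝ) (hu : ContDiff ℝ (⊤ : ℕ∞) u) (hv : ContDiff ℝ (⊤ : ℕ∞) v)
    (ε : ℝ) (hε : ε = 1 ∨ ε = -1)
    (γ : ℝ → Fin 3 → ℝ) (hγ : ∀ t, γ t = Psi (u t) (v t))
    (sp : ℝ → ℝ)
    (hsp : ∀ t, sp t =
      Real.sqrt (ε * ((deriv v t) ^ 2 * Real.cosh (u t) ^ 2 - (deriv u t) ^ 2)))
    (hnd : ∀ t ∈ Set.Icc a b,
      0 < ε * ((deriv v t) ^ 2 * Real.cosh (u t) ^ 2 - (deriv u t) ^ 2))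
    (κ : ℝ → ℝ)
    (hκ : ∀ t, κ t = ε * det3 (γ t) (deriv γ t) (deriv (deriv γ) t) / sp t ^ 3)
    (hne : ∀ t ∈ Set.Icc a b, Real.sinh (u t) + lam ≠ 0)
    (hcat : ∀ t ∈ Set.Icc a b,
      κ t = -(deriv v t * Real.cosh (u t) ^ 2) / ((Real.sinh (u t) + lam) * sp t)) :
    ∀ t₁ ∈ Set.Icc a b, ∀ t₂ ∈ Set.Icc a b,
      deriv v t₁ * Real.cosh (u t₁) ^ 2 * (Real.sinh (u t₁) + lam) / sp t₁
        = deriv v t₂ * Real.cosh (u t₂) ^ 2 * (Real.sinh (u t₂) + lam) / sp t₂ := by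
  have hu' : ContDiff ℝ (⊤ : ℕ∞) (deriv u) := (contDiff_infty_iff_deriv.mp hu).2
  have hv' : ContDiff ℝ (⊤ : ℕ∞) (deriv v) := (contDiff_infty_iff_deriv.mp hv).2
  have du : Differentiable ℝ u := hu.differentiable (by simp)
  have dv : Differentiable ℝ v := hv.differentiable (by simp)
  have du' : Differentiable ℝ (deriv u) := hu'.differentiable (by simp)
  have dv' : Differentiable ℝ (deriv v) := hv'.differentiable (by simp)
  obtain rfl : γ = fun t => Psi (u t) (v t) := funext hγ
  have key : ∀ t ∈ Set.Icc a b, HasDerivAt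
      (fun t => deriv v t * Real.cosh (u t) ^ 2 * (Real.sinh (u t) + lam) / sp t) 0 t := by
    intro t ht
    have hE := hnd t ht
    have hpos : 0 < sp t := by rw [hsp]; exact Real.sqrt_pos.mpr hE
    have hsq : sp t ^ 2 = ε * (deriv v t ^ 2 * Real.cosh (u t) ^ 2 - deriv u t ^ 2) := by
      rw [hsp, Real.sq_sqrt hE.le]
    have hsp' := (((((dv' t).hasDerivAt.pow 2).mul ((du t).hasDerivAt.cosh.pow 2)).sub
      ((du' t).hasDerivAt.pow 2)).const_mul ε).sqrt hE.ne'
    have hsp'' := hsp'.congr_of_eventuallyEq (f₁ := sp) (.of_forall hsp)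
    have hQ := (((dv' t).hasDerivAt.mul ((du t).hasDerivAt.cosh.pow 2)).mul
      ((du t).hasDerivAt.sinh.add_const lam)).div hsp'' hpos.ne'
    refine hQ.congr_deriv ?_
    have hdet := det3_Psi_curve du dv du' dv' t
    have hc := hcat t ht
    rw [hκ] at hc
    simp only [hdet] at hc
    have hl := hne t ht
    simp only [Pi.mul_apply, Pi.pow_apply, Pi.sub_apply, ← hsp]
    generalize Real.cosh (u t) = c at *
    generalize Real.sinh (u t) = s at *
    generalize deriv (deriv u) t = a₂ at *
    generalize deriv (deriv v) t = w₂ at *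
    generalize deriv u t = p at *
    generalize deriv v t = w at *
    generalize sp t = r at *
    have hr := hpos.ne'
    field_simp at hc ⊢
    norm_num
    linear_combination 2 * (s + lam) * (c ^ 2 * w₂ + 2 * w * p * s * c) * hsq + 2 * c * p * hc
  intro t₁ h₁ t₂ h₂
  have hconst := constant_of_has_deriv_right_zero
    (fun t ht => (key t ht).continuousAt.continuousWithinAt)
    (fun t ht => (key t (Set.Ico_subset_Icc_self ht)).hasDerivWithinAt)
  exact (hconst t₁ h₁).trans (hconst t₂ h₂).symm
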